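/- If f : ℝ → ℝ is smooth, vanishes at ±b together with all derivatives, and has ∫_{−b}^b f(x) dx = 0 with f not identically zero, then ∫_{−b}^b f'(x)² dx ≥ (π/b)² ∫_{−b}^b f(x)² dx, and the constant (π/b)² is the infimum of the Rayleigh quotient over this class. -/

import Mathlib

open Real intervalIntegral Set

theorem aux_memLp (a b : ℝ) (g : ℝ → ℝ) (hg : Continuous g) :
    MeasureTheory.MemLp (fun x => (g x : ℂ)) 2 (MeasureTheory.volume.restrict (Ioc a b)) := by
  have hc : Continuous (fun x => (g x : ℂ)) := by fun_prop
  have h1 : MeasureTheory.MemLp (fun x => (g x : ℂ)) 2 (MeasureTheory.volume.restrict (Icc a b)) := by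
    obtain ⟨C, hC⟩ := (isCompact_Icc (a := a) (b := b)).exists_bound_of_continuousOn hc.continuousOn
    refine MeasureTheory.MemLp.of_bound hc.aestronglyMeasurable C ?_
    filter_upwards [MeasureTheory.ae_restrict_mem measurableSet_Icc] with x hx using hC x hx
  exact h1.mono_measure (MeasureTheory.Measure.restrict_mono Ioc_subset_Icc_self le_rfl)

theorem aux_ineq (b : ℝ) (hb : 0 < b) (f : ℝ → ℝ) (hf : ContDiff ℝ (⊤ : ℕ∞) f)
    (h1 : f (-b) = 0) (h2 : f b = 0) (h0 : (∫ x in (-b)..b, f x) = 0) :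
    (π / b) ^ 2 * ∫ x in (-b)..b, (f x) ^ 2 ≤ ∫ x in (-b)..b, (deriv f x) ^ 2 := by
  have hab : -b < b := by linarith
  have hdc : Continuous (deriv f) := hf.continuous_deriv (by simp)
  have hd : Differentiable ℝ f := hf.differentiable (by simp)
  have s1 := hasSum_sq_fourierCoeffOn hab (aux_memLp (-b) b f hf.continuous)
  have m2 := aux_memLp (-b) b (deriv f) hdc
  have s2 := hasSum_sq_fourierCoeffOn hab m2
  have key : ∀ n : ℤ, (π / b) ^ 2 * ‖fourierCoeffOn hab (fun x => (f x : ℂ)) n‖ ^ 2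
      ≤ ‖fourierCoeffOn hab (fun x => ((deriv f x : ℝ) : ℂ)) n‖ ^ 2 := by
    intro n
    by_cases hn : n = 0
    · subst hn
      have : fourierCoeffOn hab (fun x => (f x : ℂ)) 0 = 0 := by
        rw [fourierCoeffOn_eq_integral]
        simp
        right
        rw [intervalIntegral.integral_ofReal, h0, Complex.ofReal_zero]
      rw [this]; simp
    · have e := fourierCoeffOn_of_hasDerivAt (f := fun x => (f x : ℂ))
        (f' := fun x => ((deriv f x : ℝ) : ℂ)) hab hn
        (fun x _ => (hd x).hasDerivAt.ofReal_comp)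
        ((Complex.continuous_ofReal.comp hdc).intervalIntegrable _ _)
      rw [e]
      simp only [h1, h2]
      rw [← mul_pow]
      have hn1 : (1 : ℝ) ≤ |(n : ℝ)| := by
        exact_mod_cast Int.one_le_abs hn
      have hbb : ‖((b : ℂ) - ((-b : ℝ) : ℂ))‖ = 2 * b := by
        rw [← Complex.ofReal_sub, Complex.norm_real, Real.norm_eq_abs, abs_of_pos (by linarith)]; ring
      have hN : ‖(1 / (-2 * π * Complex.I * n) : ℂ)‖ = 1 / (2 * π * |(n : ℝ)|) := by
        simp [abs_of_pos pi_pos]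
      apply pow_le_pow_left₀ (by positivity)
      rw [norm_mul, hN]
      simp only [sub_self, mul_zero, zero_sub, norm_neg, norm_mul, hbb]
      set c := ‖fourierCoeffOn hab (fun x => ((deriv f x : ℝ) : ℂ)) n‖
      have hc : 0 ≤ c := norm_nonneg _
      have : π / b * (1 / (2 * π * |(n:ℝ)|) * (2 * b * c)) = c / |(n:ℝ)| := by
        have := pi_pos
        field_simp
      rw [this]
      exact div_le_self hc hn1
  have := hasSum_le key (s1.mul_left _) s2
  simp only [Complex.norm_real, Real.norm_eq_abs, sq_abs, smul_eq_mul] at this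
  have hp : 0 < (b - -b)⁻¹ := by apply inv_pos.2; linarith
  rw [mul_left_comm] at this
  exact le_of_mul_le_mul_left this hp

theorem aux_sq_pos (b : ℝ) (hb : 0 < b) (f : ℝ → ℝ) (hf : Continuous f)
    (hn : ¬ (∀ x ∈ Icc (-b) b, f x = 0)) : 0 < ∫ x in (-b)..b, (f x) ^ 2 := by
  push Not at hn
  obtain ⟨c, hc, hfc⟩ := hn
  exact intervalIntegral.integral_pos (by linarith) (by fun_prop) (fun x _ => sq_nonneg _)
    ⟨c, hc, by positivity⟩

noncomputable def auxPhi (s : ℝ) : ℝ := s * Real.smoothTransition (s ^ 2 - 1)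

theorem auxPhi_contDiff : ContDiff ℝ (⊤ : ℕ∞) auxPhi := by
  unfold auxPhi
  exact contDiff_id.mul (Real.smoothTransition.contDiff.comp (by fun_prop))

theorem auxPhi_abs_le (s : ℝ) : |auxPhi s| ≤ |s| := by
  unfold auxPhi
  rw [abs_mul, abs_of_nonneg (Real.smoothTransition.nonneg _)]
  exact mul_le_of_le_one_right (abs_nonneg _) (Real.smoothTransition.le_one _)

theorem auxPhi_zero (s : ℝ) (h : s ^ 2 ≤ 1) : auxPhi s = 0 := by
  unfold auxPhi
  rw [Real.smoothTransition.zero_of_nonpos (by linarith), mul_zero]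

theorem auxPhi_id (s : ℝ) (h : 2 ≤ s ^ 2) : auxPhi s = s := by
  unfold auxPhi
  rw [Real.smoothTransition.one_of_one_le (by linarith), mul_one]

theorem auxPhi_deriv_one (s : ℝ) (h : 2 < s ^ 2) : deriv auxPhi s = 1 := by
  have : auxPhi =ᶠ[nhds s] id := by
    have : ∀ᶠ t in nhds s, 2 < t ^ 2 := (continuous_pow 2).continuousAt.eventually (lt_mem_nhds h)
    filter_upwards [this] with t ht using auxPhi_id t ht.le
  rw [this.deriv_eq]; simp

theorem auxPhi_deriv_bound : ∃ C : ℝ, ∀ s, |deriv auxPhi s| ≤ C := by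
  have hdc : Continuous (deriv auxPhi) := auxPhi_contDiff.continuous_deriv (by simp)
  obtain ⟨C, hC⟩ := (isCompact_Icc (a := (-2:ℝ)) (b := 2)).exists_bound_of_continuousOn hdc.continuousOn
  refine ⟨max C 1, fun s => ?_⟩
  by_cases h : s ∈ Icc (-2:ℝ) 2
  · exact (hC s h).trans (le_max_left _ _)
  · rw [auxPhi_deriv_one s]
    · simp
    · by_contra! h'
      exact h ⟨by nlinarith, by nlinarith⟩

noncomputable def auxF (b : ℝ) (n : ℕ) (x : ℝ) : ℝ :=
  auxPhi (((n : ℝ) + 1) * sin (π / b * x)) / ((n : ℝ) + 1)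

theorem auxF_contDiff (b : ℝ) (n : ℕ) : ContDiff ℝ (⊤ : ℕ∞) (auxF b n) := by
  unfold auxF
  exact (auxPhi_contDiff.comp (by fun_prop)).div_const _

theorem auxF_deriv (b : ℝ) (n : ℕ) (x : ℝ) :
    deriv (auxF b n) x = deriv auxPhi (((n : ℝ) + 1) * sin (π / b * x)) * (π / b * cos (π / b * x)) := by
  have h1 : HasDerivAt (fun x => ((n : ℝ) + 1) * sin (π / b * x))
      (((n : ℝ) + 1) * (cos (π / b * x) * (π / b * 1))) x :=
    (((hasDerivAt_id x).const_mul (π / b)).sin).const_mul _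
  have h2 : HasDerivAt auxPhi _ (((n : ℝ) + 1) * sin (π / b * x)) :=
    (auxPhi_contDiff.differentiable (by simp) _).hasDerivAt
  have h3 := (h2.comp x h1).div_const ((n : ℝ) + 1)
  have h4 : deriv (auxF b n) x = _ := h3.deriv
  rw [h4]
  have : (n : ℝ) + 1 ≠ 0 := by positivity
  field_simp

theorem auxF_odd (b : ℝ) (n : ℕ) (x : ℝ) : auxF b n (-x) = - auxF b n x := by
  unfold auxF auxPhi
  simp [mul_neg, neg_div]

theorem auxF_mean (b : ℝ) (n : ℕ) : (∫ x in (-b)..b, auxF b n x) = 0 := by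
  have h := intervalIntegral.integral_comp_neg (a := -b) (b := b) (fun x => auxF b n x)
  simp only [auxF_odd, intervalIntegral.integral_neg, neg_neg] at h
  linarith

theorem auxF_flat (b : ℝ) (n : ℕ) (y : ℝ) (hy : sin (π / b * y) = 0) (k : ℕ) :
    iteratedDeriv k (auxF b n) y = 0 := by
  have : auxF b n =ᶠ[nhds y] fun _ => 0 := by
    have hc : Continuous (fun x => (((n : ℝ) + 1) * sin (π / b * x)) ^ 2) := by fun_prop
    have : ∀ᶠ t in nhds y, (((n : ℝ) + 1) * sin (π / b * t)) ^ 2 < 1 :=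
      hc.continuousAt.eventually (gt_mem_nhds (by simp [hy]))
    filter_upwards [this] with t ht
    unfold auxF
    rw [auxPhi_zero _ ht.le, zero_div]
  rw [Filter.EventuallyEq.iteratedDeriv_eq k this]
  simp

theorem aux_ae (b : ℝ) (hb : 0 < b) :
    ∀ᵐ x ∂MeasureTheory.volume, x ∈ Set.uIoc (-b) b → sin (π / b * x) ≠ 0 := by
  have h : MeasureTheory.volume ({0, b} : Set ℝ) = 0 := (Set.toFinite _).measure_zero _
  have h' : ∀ᵐ x ∂MeasureTheory.volume, x ∉ ({0, b} : Set ℝ) := MeasureTheory.measure_eq_zero_iff_ae_notMem.1 h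
  filter_upwards [h'] with x hx hxm h0
  rw [Set.uIoc_of_le (by linarith)] at hxm
  simp only [mem_insert_iff, mem_singleton_iff, not_or] at hx
  have hxb : x < b := lt_of_le_of_ne hxm.2 hx.2
  have hk : 0 < π / b := by positivity
  have e : π / b * b = π := by field_simp
  have := (sin_eq_zero_iff_of_lt_of_lt (x := π / b * x) (by nlinarith [hxm.1]) (by nlinarith)).1 h0
  rcases mul_eq_zero.1 this with h | h
  · exact hk.ne' h
  · exact hx.1 h

theorem aux_large (s : ℝ) (hs : s ≠ 0) : ∀ᶠ n : ℕ in Filter.atTop, 2 < (((n : ℝ) + 1) * s) ^ 2 := by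
  have : Filter.Tendsto (fun n : ℕ => (((n : ℝ) + 1) * |s|)) Filter.atTop Filter.atTop :=
    (Filter.tendsto_atTop_add_const_right _ _ tendsto_natCast_atTop_atTop).atTop_mul_const (abs_pos.2 hs)
  filter_upwards [this.eventually_gt_atTop 2] with n hn
  have e : (((n : ℝ) + 1) * s) ^ 2 = (((n : ℝ) + 1) * |s|) ^ 2 := by
    rw [mul_pow, mul_pow, sq_abs]
  rw [e]; nlinarith

theorem aux_lim1 (b : ℝ) (hb : 0 < b) :
    Filter.Tendsto (fun n : ℕ => ∫ x in (-b)..b, (auxF b n x) ^ 2) Filter.atTop (nhds b) := by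
  have hI : ∫ x in (-b)..b, (sin (π / b * x)) ^ 2 = b := by
    rw [intervalIntegral.integral_comp_mul_left (fun x => sin x ^ 2) (by positivity), integral_sin_sq]
    have e : π / b * b = π := by field_simp
    rw [mul_neg, e]
    simp
  have := intervalIntegral.tendsto_integral_filter_of_dominated_convergence
    (μ := MeasureTheory.volume) (a := -b) (b := b) (l := Filter.atTop)
    (F := fun (n : ℕ) x => (auxF b n x) ^ 2) (f := fun x => (sin (π / b * x)) ^ 2) (fun _ => 1)
    (Filter.Eventually.of_forall fun n => ((auxF_contDiff b n).continuous.pow 2).aestronglyMeasurable)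
    (Filter.Eventually.of_forall fun n => Filter.Eventually.of_forall fun x _ => ?_)
    intervalIntegrable_const ?_
  · rwa [hI] at this
  · have hp : (0:ℝ) < (n : ℝ) + 1 := by positivity
    have : |auxF b n x| ≤ 1 := by
      unfold auxF
      rw [abs_div, abs_of_pos hp, div_le_one hp]
      refine (auxPhi_abs_le _).trans ?_
      rw [abs_mul, abs_of_pos hp]
      exact mul_le_of_le_one_right hp.le (abs_sin_le_one _)
    rw [norm_pow, Real.norm_eq_abs]
    exact pow_le_one₀ (abs_nonneg _) this
  · filter_upwards [aux_ae b hb] with x hx hxm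
    refine tendsto_const_nhds.congr' ?_
    filter_upwards [aux_large _ (hx hxm)] with n hn
    unfold auxF
    rw [auxPhi_id _ hn.le]
    field_simp

theorem aux_lim2 (b : ℝ) (hb : 0 < b) :
    Filter.Tendsto (fun n : ℕ => ∫ x in (-b)..b, (deriv (auxF b n) x) ^ 2) Filter.atTop
      (nhds ((π / b) ^ 2 * b)) := by
  have hI : ∫ x in (-b)..b, (π / b * cos (π / b * x)) ^ 2 = (π / b) ^ 2 * b := by
    simp only [mul_pow]
    rw [intervalIntegral.integral_const_mul,
      intervalIntegral.integral_comp_mul_left (fun x => cos x ^ 2) (by positivity), integral_cos_sq]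
    have e : π / b * b = π := by field_simp
    rw [mul_neg, e]
    simp
  obtain ⟨C, hC⟩ := auxPhi_deriv_bound
  have := intervalIntegral.tendsto_integral_filter_of_dominated_convergence
    (μ := MeasureTheory.volume) (a := -b) (b := b) (l := Filter.atTop)
    (F := fun (n : ℕ) x => (deriv (auxF b n) x) ^ 2) (f := fun x => (π / b * cos (π / b * x)) ^ 2)
    (fun _ => (C * (π / b)) ^ 2)
    (Filter.Eventually.of_forall fun n =>
      (((auxF_contDiff b n).continuous_deriv (by simp)).pow 2).aestronglyMeasurable)
    (Filter.Eventually.of_forall fun n => Filter.Eventually.of_forall fun x _ => ?_)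
    intervalIntegrable_const ?_
  · rwa [hI] at this
  · rw [norm_pow, Real.norm_eq_abs, auxF_deriv, abs_mul, abs_mul]
    have hk : 0 < π / b := by positivity
    rw [abs_of_pos hk]
    apply pow_le_pow_left₀ (by positivity)
    have hC0 : 0 ≤ C := (abs_nonneg _).trans (hC 0)
    refine mul_le_mul (hC _) ?_ (by positivity) hC0
    exact mul_le_of_le_one_right hk.le (abs_cos_le_one _)
  · filter_upwards [aux_ae b hb] with x hx hxm
    refine tendsto_const_nhds.congr' ?_
    filter_upwards [aux_large _ (hx hxm)] with n hn
    rw [auxF_deriv, auxPhi_deriv_one _ hn, one_mul]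

/-- For smooth `f` on `ℝ` vanishing at `±b` with all derivatives, with zero mean on
`[−b,b]` and not identically zero there, one has
`∫_{−b}^b (f')² ≥ (π/b)² ∫_{−b}^b f²`, and `(π/b)²` is the infimum (greatest lower
bound) of the Rayleigh quotient over this class. -/
theorem second_eigenvalue_sharp (b : ℝ) (hb : 0 < b) :
    (∀ f : ℝ → ℝ, ContDiff ℝ (⊤ : ℕ∞) f →
        (∀ k : ℕ, iteratedDeriv k f (-b) = 0 ∧ iteratedDeriv k f b = 0) →
        (∫ x in (-b)..b, f x) = 0 →
        ¬ (∀ x ∈ Icc (-b) b, f x = 0) →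
        (π / b) ^ 2 * ∫ x in (-b)..b, (f x) ^ 2 ≤ ∫ x in (-b)..b, (deriv f x) ^ 2) ∧
    IsGLB { q : ℝ | ∃ f : ℝ → ℝ, ContDiff ℝ (⊤ : ℕ∞) f ∧
        (∀ k : ℕ, iteratedDeriv k f (-b) = 0 ∧ iteratedDeriv k f b = 0) ∧
        (∫ x in (-b)..b, f x) = 0 ∧
        ¬ (∀ x ∈ Icc (-b) b, f x = 0) ∧
        q = (∫ x in (-b)..b, (deriv f x) ^ 2) / ∫ x in (-b)..b, (f x) ^ 2 }
      ((π / b) ^ 2) := by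

  have hk : 0 < π / b := by positivity
  have e : π / b * b = π := by field_simp
  have part1 : ∀ f : ℝ → ℝ, ContDiff ℝ (⊤ : ℕ∞) f →
        (∀ k : ℕ, iteratedDeriv k f (-b) = 0 ∧ iteratedDeriv k f b = 0) →
        (∫ x in (-b)..b, f x) = 0 →
        (π / b) ^ 2 * ∫ x in (-b)..b, (f x) ^ 2 ≤ ∫ x in (-b)..b, (deriv f x) ^ 2 := by
    intro f hf hk h0
    have h := hk 0
    simp only [iteratedDeriv_zero] at h
    exact aux_ineq b hb f hf h.1 h.2 h0
  refine ⟨fun f hf hk h0 _ => part1 f hf hk h0, ?_, ?_⟩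
  · rintro q ⟨f, hf, hk, h0, hn, rfl⟩
    rw [le_div_iff₀ (aux_sq_pos b hb f hf.continuous hn)]
    exact part1 f hf hk h0
  · intro m hm
    have hl := (aux_lim2 b hb).div (aux_lim1 b hb) hb.ne'
    rw [mul_div_cancel_right₀ _ hb.ne'] at hl
    refine ge_of_tendsto hl ?_
    filter_upwards [(aux_lim1 b hb).eventually (lt_mem_nhds hb)] with n hn
    apply hm
    refine ⟨auxF b n, auxF_contDiff b n, fun k => ⟨auxF_flat b n _ ?_ k, auxF_flat b n _ ?_ k⟩,
      auxF_mean b n, ?_, rfl⟩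
    · rw [mul_neg, e]; simp
    · rw [e]; simp
    · intro hz
      have : ∫ x in (-b)..b, (auxF b n x) ^ 2 = ∫ x in (-b)..b, (0:ℝ) := by
        apply intervalIntegral.integral_congr
        intro x hx
        rw [Set.uIcc_of_le (by linarith)] at hx
        simp [hz x hx]
      rw [this] at hn
      simp at hn
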